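/- arXiv:2111.02903 — 2 statements merged into one kernel-verified Lean document; each statement's English description precedes it below -/
import Mathlib

section
/- Let X be a finite set and R a reflexive and symmetric relation on X. Let L be the complex X×X matrix with L x y = 1 if (x,y) ∈ R and L x y = 0 otherwise. Then the Schur–Hadamard multiplication map S_L : M ↦ L ⊙ M (entrywise product) maps positive semidefinite matrices to positive semidefinite matrices if and only if R is transitive (i.e., R is an equivalence relation). -/
open scoped ComplexOrder

/-- The 0-1 matrix of an equivalence relation is positive semidefinite: it is the pullback of the
identity matrix along the quotient map. -/
theorem posSemidef_of_equivalence {X : Type*} (R : X → X → Prop) [DecidableRel R]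
    (hR : Equivalence R) : (Matrix.of fun x y => if R x y then (1 : ℂ) else 0).PosSemidef := by
  classical
  let s : Setoid X := ⟨R, hR⟩
  have h : (Matrix.of fun x y => if R x y then (1 : ℂ) else 0) =
      (1 : Matrix (Quotient s) (Quotient s) ℂ).submatrix (Quotient.mk s) (Quotient.mk s) := by
    ext x y
    have hxy : Quotient.mk s x = Quotient.mk s y ↔ R x y := Quotient.eq
    simp [Matrix.one_apply, hxy]
  rw [h]
  exact Matrix.PosSemidef.one.submatrix _

/-- A reflexive symmetric relation with positive semidefinite 0-1 matrix is transitive: if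
`R x y` and `R y z` but not `R x z`, then the vector `(1, -1, 1)` on `(x, y, z)` is negative. -/
theorem transitive_of_posSemidef {X : Type*} (R : X → X → Prop) [DecidableRel R]
    (hrefl : ∀ x, R x x) (hsymm : ∀ x y, R x y → R y x)
    (h : (Matrix.of fun x y => if R x y then (1 : ℂ) else 0).PosSemidef)
    (x y z : X) (hxy : R x y) (hyz : R y z) : R x z := by
  by_contra hxz
  have hzx : ¬ R z x := fun hzx => hxz (hsymm _ _ hzx)
  have hnonneg :=
    (Matrix.posSemidef_iff_dotProduct_mulVec.mp (h.submatrix ![x, y, z])).2 ![1, -1, 1]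
  simp [Matrix.mulVec, dotProduct, Fin.sum_univ_three, hrefl, hxy, hyz, hxz, hzx,
    hsymm _ _ hxy, hsymm _ _ hyz] at hnonneg
  norm_num [Complex.le_def] at hnonneg

/-- Schur–Hadamard multiplication by the 0-1 matrix `L` of a reflexive
symmetric relation `R` preserves positive semidefiniteness iff `R` is transitive
(i.e. an equivalence relation). -/
theorem stmt6 {X : Type*} [Fintype X] (R : X → X → Prop) [DecidableRel R]
    (hrefl : ∀ x, R x x) (hsymm : ∀ x y, R x y → R y x)
    (L : Matrix X X ℂ) (hL : ∀ x y, L x y = if R x y then 1 else 0) :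
    (∀ M : Matrix X X ℂ, M.PosSemidef → (Matrix.hadamard L M).PosSemidef) ↔
      ∀ x y z, R x y → R y z → R x z := by
  obtain rfl : L = Matrix.of fun x y => if R x y then (1 : ℂ) else 0 := Matrix.ext hL
  constructor
  · intro h
    refine transitive_of_posSemidef R hrefl hsymm ?_
    convert h _ (Matrix.posSemidef_vecMulVec_self_star (1 : X → ℂ)) using 1
    ext x y
    simp
  · intro htrans M hM
    exact (posSemidef_of_equivalence R ⟨hrefl, hsymm _ _, htrans _ _ _⟩).hadamard hM
end

section
/- Let A be a complex C*-algebra, E ⊆ A a closed *-subspace, 𝓐 ⊆ A a dense *-subspace with 𝓔 := E ∩ 𝓐 dense in E, and (e_λ)_{λ∈Λ} a norm-defining approximate order unit for 𝓐 contained in 𝓔. Then the restriction map from hermitian bounded functionals on A to hermitian bounded functionals on E induces an isometric order isomorphism of the quotient by the annihilator of E onto the hermitian part of the dual of E. Concretely: (a) for every hermitian bounded linear functional φ on A, ‖φ|_E‖ = inf{ ‖φ + η‖ : η a hermitian bounded functional on A with η|_E = 0 }; (b) every hermitian bounded functional on E is the restriction of a hermitian bounded functional on A; and (c) for a hermitian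 bounded functional φ on A, the restriction φ|_E is positive if and only if there exists a hermitian bounded functional η on A with η|_E = 0 such that φ + η is positive on A. -/
open scoped ComplexOrder

/-- A hermitian bounded functional on a `*`-subspace extends to a hermitian bounded functional of
the same norm. -/
theorem exists_hermitian_extension_norm_eq {A : Type*} [NormedAddCommGroup A] [StarAddMonoid A]
    [NormedStarGroup A] [NormedSpace ℂ A] [StarModule ℂ A]
    (E : Submodule ℂ A) (hE : ∀ x ∈ E, star x ∈ E) (ψ : E →L[ℂ] ℂ)
    (hψ : ∀ x : E, ψ ⟨star (x : A), hE (x : A) x.2⟩ = starRingEnd ℂ (ψ x)) :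
    ∃ φ : A →L[ℂ] ℂ, (∀ a : A, φ (star a) = starRingEnd ℂ (φ a)) ∧
      (∀ x : E, φ (x : A) = ψ x) ∧ ‖φ‖ = ‖ψ‖ := by
  obtain ⟨g, hg, hgn⟩ := exists_extension_norm_eq E ψ
  let φ₀ : A →ₗ[ℂ] ℂ :=
    { toFun := fun a => (g a + starRingEnd ℂ (g (star a))) / 2
      map_add' := fun a b => by simp only [star_add, map_add]; ring
      map_smul' := fun c a => by
        simp only [star_smul, map_smul, smul_eq_mul, map_mul, RingHom.id_apply, Complex.star_def,
          Complex.conj_conj]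
        ring }
  let φ : A →L[ℂ] ℂ := φ₀.mkContinuous ‖ψ‖ fun a => by
    have h₁ := g.le_opNorm a
    have h₂ := g.le_opNorm (star a)
    rw [norm_star] at h₂
    have h₃ := norm_add_le (g a) (starRingEnd ℂ (g (star a)))
    rw [RCLike.norm_conj] at h₃
    have h₄ : ‖φ₀ a‖ = ‖g a + starRingEnd ℂ (g (star a))‖ / 2 := by simp [φ₀]
    rw [h₄, ← hgn]
    linarith
  have hφ : ∀ a, φ a = (g a + starRingEnd ℂ (g (star a))) / 2 := fun _ => rfl
  have hext : ∀ x : E, φ (x : A) = ψ x := fun x => by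
    have h := hg ⟨star (x : A), hE (x : A) x.2⟩
    simp only at h
    rw [hφ, h, hg, hψ, Complex.conj_conj]
    ring
  refine ⟨φ, fun a => ?_, hext, le_antisymm ?_ ?_⟩
  · rw [hφ, hφ, star_star, map_div₀, map_add, Complex.conj_conj, map_ofNat, add_comm]
  · exact φ₀.mkContinuous_norm_le (norm_nonneg ψ) _
  · refine ψ.opNorm_le_bound (norm_nonneg _) fun x => ?_
    rw [← hext x]
    exact φ.le_opNorm (x : A)

/-- The difference of two positive contractions in a C⋆-algebra is a contraction. -/
theorem norm_sub_le_one_of_nonneg {A : Type*} [NonUnitalCStarAlgebra A] [PartialOrder A]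
    [StarOrderedRing A] {a b : A} (ha : 0 ≤ a) (hb : 0 ≤ b) (ha₁ : ‖a‖ ≤ 1) (hb₁ : ‖b‖ ≤ 1) :
    ‖a - b‖ ≤ 1 := by
  obtain ⟨ha₀, ha₂⟩ := (CStarAlgebra.inr_mem_Icc_iff_norm_le (x := a)).2 ⟨ha, ha₁⟩
  obtain ⟨hb₀, hb₂⟩ := (CStarAlgebra.inr_mem_Icc_iff_norm_le (x := b)).2 ⟨hb, hb₁⟩
  rw [← Unitization.norm_inr (𝕜 := ℂ), Unitization.inr_sub]
  have hsa : IsSelfAdjoint ((a : Unitization ℂ A) - (b : Unitization ℂ A)) :=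
    ha₀.isSelfAdjoint.sub hb₀.isSelfAdjoint
  have hle : (a : Unitization ℂ A) - (b : Unitization ℂ A) ≤ algebraMap ℝ _ 1 := by
    rw [map_one]
    exact (sub_le_self _ hb₀).trans ha₂
  have hge : algebraMap ℝ _ (-1) ≤ (a : Unitization ℂ A) - (b : Unitization ℂ A) := by
    rw [map_neg, map_one]
    exact (neg_le_neg hb₂).trans (by simpa using ha₀)
  rw [le_algebraMap_iff_spectrum_le] at hle
  rw [algebraMap_le_iff_le_spectrum] at hge
  rcases CStarAlgebra.norm_or_neg_norm_mem_spectrum hsa with h | h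
  · exact hle _ h
  · linarith [hge _ h]

/-- If the `2 × 2` matrix with diagonal `b, b` and off-diagonal `x, star x` is positive, then
`x + star x ≤ 2 b`. -/
theorem add_star_le_of_matrix_eq_star_mul_self {A : Type*} [NonUnitalRing A] [StarRing A]
    [PartialOrder A] [StarOrderedRing A] {b x : A} {z : Matrix (Fin 2) (Fin 2) A}
    (h : !![b, x; star x, b] = star z * z) : 0 ≤ b + b - (x + star x) := by
  have h₀₀ := congrFun (congrFun h 0) 0
  have h₀₁ := congrFun (congrFun h 0) 1
  have h₁₀ := congrFun (congrFun h 1) 0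
  have h₁₁ := congrFun (congrFun h 1) 1
  simp [Matrix.mul_apply, Matrix.star_apply, Fin.sum_univ_two] at h₀₀ h₀₁ h₁₀ h₁₁
  have key : b + b - (x + star x) = star (z 0 0 - z 0 1) * (z 0 0 - z 0 1) +
      star (z 1 0 - z 1 1) * (z 1 0 - z 1 1) := by
    nth_rewrite 2 [h₁₁]
    rw [h₀₀, h₁₀, h₀₁]
    simp only [star_sub, sub_mul, mul_sub]
    abel
  rw [key]
  exact add_nonneg (star_mul_self_nonneg _) (star_mul_self_nonneg _)

/-- A positive element `b` makes the `2 × 2` matrix with all entries `b` positive. -/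
theorem exists_matrix_eq_star_mul_self {A : Type*} [NonUnitalCStarAlgebra A] [PartialOrder A]
    [StarOrderedRing A] {b : A} (hb : 0 ≤ b) :
    ∃ z : Matrix (Fin 2) (Fin 2) A, !![b, b; star b, b] = star z * z := by
  have hs : star (CFC.sqrt b) = CFC.sqrt b := (CFC.sqrt_nonneg b).isSelfAdjoint
  have hb' : star b = b := hb.isSelfAdjoint
  have hss := CFC.sqrt_mul_sqrt_self b hb
  refine ⟨!![CFC.sqrt b, CFC.sqrt b; 0, 0], ?_⟩
  ext i j
  fin_cases i <;> fin_cases j <;>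
    simp [Matrix.mul_apply, Fin.sum_univ_two, Matrix.star_apply, hs, hb', hss]

/-- A functional whose real part is dominated by `c * ‖·‖` on a subspace has norm at most `c` on
the closure of that subspace. -/
theorem norm_apply_le_of_re_le {A : Type*} [NormedAddCommGroup A] [NormedSpace ℂ A]
    (S : Submodule ℂ A) (φ : A →L[ℂ] ℂ) {c : ℝ} (h : ∀ x ∈ S, (φ x).re ≤ c * ‖x‖)
    {x : A} (hx : x ∈ closure (S : Set A)) : ‖φ x‖ ≤ c * ‖x‖ := by
  have hcl : IsClosed {x : A | ‖φ x‖ ≤ c * ‖x‖} := isClosed_le (by fun_prop) (by fun_prop)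
  refine closure_minimal (fun y hy => ?_) hcl hx
  rcases eq_or_ne (φ y) 0 with h₀ | h₀
  · have h₁ := h y hy
    simpa [h₀] using h₁
  · have hn : (‖φ y‖ : ℂ) ≠ 0 := by simpa using h₀
    have h₁ := h _ (S.smul_mem (starRingEnd ℂ (φ y) / ‖φ y‖) hy)
    have h₂ : φ ((starRingEnd ℂ (φ y) / ‖φ y‖) • y) = (‖φ y‖ : ℂ) := by
      rw [map_smul, smul_eq_mul, div_mul_eq_mul_div, mul_comm, Complex.mul_conj,
        Complex.normSq_eq_norm_sq, div_eq_iff hn]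
      push_cast
      ring
    rw [h₂, Complex.ofReal_re, norm_smul, norm_div, RCLike.norm_conj, Complex.norm_real, norm_norm,
      div_self (by simpa using h₀), one_mul] at h₁
    exact h₁

/-- Under the approximate-order-unit hypotheses, restriction of hermitian
bounded functionals from `A` to `E` induces an isometric order isomorphism
`(A*)_h / (E^⊥)_h ≅ (E*)_h`. Concretely: (a) the norm of the restriction equals the quotient
norm; (b) every hermitian bounded functional on `E` is a restriction of a hermitian bounded
functional on `A`; (c) the restriction is positive iff some hermitian correction vanishing on
`E` makes the functional positive on all of `A`. -/
theorem stmt16 {A : Type*} [NonUnitalNormedRing A] [StarRing A] [CStarRing A]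
    [NormedSpace ℂ A] [StarModule ℂ A] [SMulCommClass ℂ A A] [IsScalarTower ℂ A A]
    [CompleteSpace A] [PartialOrder A] [StarOrderedRing A]
    (E : Submodule ℂ A) (hEclosed : IsClosed (E : Set A)) (hEstar : ∀ x ∈ E, star x ∈ E)
    (𝓐 : Submodule ℂ A) (h𝓐dense : Dense (𝓐 : Set A)) (h𝓐star : ∀ x ∈ 𝓐, star x ∈ 𝓐)
    (h𝓔dense : (E : Set A) ⊆ closure ((E ⊓ 𝓐 : Submodule ℂ A) : Set A))
    {Λ : Type*} [Nonempty Λ] [Preorder Λ] [IsDirected Λ (· ≤ ·)]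
    (e : Λ → A) (heE : ∀ l, e l ∈ E) (he𝓐 : ∀ l, e l ∈ 𝓐)
    (hepos : ∀ l, 0 ≤ e l) (hemono : Monotone e)
    (hnorm : ∀ x ∈ 𝓐, ‖x‖ = sInf {t : ℝ | 0 ≤ t ∧ ∃ l : Λ,
      ∃ z : Matrix (Fin 2) (Fin 2) A,
        !![(t : ℂ) • e l, x; star x, (t : ℂ) • e l] = star z * z}) :
    (∀ φ : A →L[ℂ] ℂ, (∀ a : A, φ (star a) = starRingEnd ℂ (φ a)) →
      ‖φ.comp E.subtypeL‖ = sInf {r : ℝ | ∃ η : A →L[ℂ] ℂ,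
        (∀ a : A, η (star a) = starRingEnd ℂ (η a)) ∧ (∀ x ∈ E, η x = 0) ∧
        r = ‖φ + η‖}) ∧
    (∀ ψ : E →L[ℂ] ℂ,
      (∀ x : E, ψ ⟨star (x : A), hEstar (x : A) x.2⟩ = starRingEnd ℂ (ψ x)) →
      ∃ φ : A →L[ℂ] ℂ, (∀ a : A, φ (star a) = starRingEnd ℂ (φ a)) ∧
        ∀ x : E, φ (x : A) = ψ x) ∧
    (∀ φ : A →L[ℂ] ℂ, (∀ a : A, φ (star a) = starRingEnd ℂ (φ a)) →
      ((∀ x : E, 0 ≤ (x : A) → 0 ≤ φ (x : A)) ↔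
        ∃ η : A →L[ℂ] ℂ, (∀ a : A, η (star a) = starRingEnd ℂ (η a)) ∧
          (∀ x ∈ E, η x = 0) ∧ ∀ a : A, 0 ≤ a → 0 ≤ (φ + η) a)) := by
  let _ : NonUnitalCStarAlgebra A := { }
  have hres : ∀ φ : A →L[ℂ] ℂ, (∀ a : A, φ (star a) = starRingEnd ℂ (φ a)) →
      ∃ η : A →L[ℂ] ℂ, (∀ a : A, η (star a) = starRingEnd ℂ (η a)) ∧ (∀ x ∈ E, η x = 0) ∧
        ‖φ + η‖ = ‖φ.comp E.subtypeL‖ := by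
    intro φ hφ
    obtain ⟨g, hg, hgE, hgn⟩ := exists_hermitian_extension_norm_eq E hEstar (φ.comp E.subtypeL)
      fun x => hφ (x : A)
    refine ⟨g - φ, fun a => ?_, fun x hx => ?_, ?_⟩
    · simp [hg, hφ]
    · simpa [sub_eq_zero] using hgE ⟨x, hx⟩
    · rw [add_sub_cancel, hgn]
  refine ⟨fun φ hφ => ?_, fun ψ hψ => ?_, fun φ hφ => ⟨fun hpos => ?_, ?_⟩⟩
  · obtain ⟨η, hη, hηE, hηn⟩ := hres φ hφ
    symm
    refine IsLeast.csInf_eq ⟨⟨η, hη, hηE, hηn.symm⟩, ?_⟩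
    rintro r ⟨η, -, hηE, rfl⟩
    refine ContinuousLinearMap.opNorm_le_bound _ (norm_nonneg _) fun x => ?_
    have h := (φ + η).le_opNorm (x : A)
    rwa [add_apply, hηE _ x.2, add_zero] at h
  · obtain ⟨φ, hφ, hφE, -⟩ := exists_hermitian_extension_norm_eq E hEstar ψ hψ
    exact ⟨φ, hφ, hφE⟩
  · obtain ⟨η, hη, hηE, hηn⟩ := hres φ hφ
    refine ⟨η, hη, hηE, ?_⟩
    have he₁ : ∀ l, ‖e l‖ ≤ 1 := fun l => by
      rw [hnorm _ (he𝓐 l)]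
      refine csInf_le ⟨0, fun t ht => ht.1⟩ ⟨zero_le_one, l, ?_⟩
      simpa using exists_matrix_eq_star_mul_self (hepos l)
    have hbdd : BddAbove (Set.range fun l => (φ (e l)).re) := by
      refine ⟨‖φ‖, ?_⟩
      rintro _ ⟨l, rfl⟩
      exact (Complex.re_le_norm _).trans (φ.unit_le_opNorm _ (he₁ l))
    have hle : ∀ l, (φ (e l)).re ≤ ⨆ l, (φ (e l)).re := fun l => le_ciSup hbdd l
    have hc : 0 ≤ ⨆ l, (φ (e l)).re :=
      Real.iSup_nonneg fun l => (Complex.nonneg_iff.1 (hpos ⟨e l, heE l⟩ (hepos l))).1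
    have hre : ∀ x ∈ E ⊓ 𝓐, (φ x).re ≤ (⨆ l, (φ (e l)).re) * ‖x‖ := by
      rintro x ⟨hxE, hx𝓐⟩
      rcases eq_or_ne x 0 with rfl | hx
      · simp
      have hne : {t : ℝ | 0 ≤ t ∧ ∃ l : Λ, ∃ z : Matrix (Fin 2) (Fin 2) A,
          !![(t : ℂ) • e l, x; star x, (t : ℂ) • e l] = star z * z}.Nonempty := by
        by_contra hempty
        have h := hnorm x hx𝓐
        rw [Set.not_nonempty_iff_eq_empty.1 hempty, Real.sInf_empty] at h
        exact hx (norm_eq_zero.1 h)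
      refine le_of_forall_pos_le_add fun ε hε => ?_
      obtain ⟨δ, hδ, hδε⟩ : ∃ δ > 0, (⨆ l, (φ (e l)).re) * δ ≤ ε := by
        refine ⟨ε / ((⨆ l, (φ (e l)).re) + 1), by positivity, ?_⟩
        rw [mul_div_assoc', div_le_iff₀ (by positivity)]
        nlinarith
      obtain ⟨t, ⟨ht₀, l, z, hz⟩, ht⟩ := exists_lt_of_csInf_lt hne
        (show _ < ‖x‖ + δ by rw [← hnorm x hx𝓐]; linarith)
      have hmem : (t : ℂ) • e l + (t : ℂ) • e l - (x + star x) ∈ E :=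
        E.sub_mem (E.add_mem (E.smul_mem _ (heE l)) (E.smul_mem _ (heE l)))
          (E.add_mem hxE (hEstar x hxE))
      have h := (Complex.nonneg_iff.1
        (hpos ⟨_, hmem⟩ (add_star_le_of_matrix_eq_star_mul_self hz))).1
      simp [hφ] at h
      nlinarith [mul_le_mul_of_nonneg_left (hle l) ht₀]
    have hn : ‖φ + η‖ ≤ ⨆ l, (φ (e l)).re := by
      rw [hηn]
      exact ContinuousLinearMap.opNorm_le_bound _ hc fun x =>
        norm_apply_le_of_re_le (E ⊓ 𝓐) φ hre (h𝓔dense x.2)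
    have him : ∀ a : A, 0 ≤ a → ((φ + η) a).im = 0 := fun a ha => by
      have hsa : star a = a := ha.isSelfAdjoint
      have h : starRingEnd ℂ ((φ + η) a) = (φ + η) a := by
        rw [add_apply, map_add, ← hφ, ← hη, hsa]
      exact Complex.conj_eq_iff_im.1 h
    have hunit : ∀ a : A, 0 ≤ a → ‖a‖ ≤ 1 → 0 ≤ ((φ + η) a).re := fun a ha ha₁ => by
      have h : (⨆ l, (φ (e l)).re) ≤ ‖φ + η‖ + ((φ + η) a).re := ciSup_le fun l => by
        have h₁ := (Complex.re_le_norm _).trans ((φ + η).unit_le_opNorm _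
          (norm_sub_le_one_of_nonneg (hepos l) ha (he₁ l) ha₁))
        rw [map_sub, Complex.sub_re] at h₁
        have h₂ : (φ + η) (e l) = φ (e l) := by simp [hηE _ (heE l)]
        rw [h₂] at h₁
        linarith
      linarith
    intro a ha
    refine Complex.nonneg_iff.2 ⟨?_, (him a ha).symm⟩
    rcases eq_or_ne a 0 with rfl | h₀
    · simp
    have hpos' : 0 < ‖a‖ := norm_pos_iff.2 h₀
    have h := hunit (‖a‖⁻¹ • a) (smul_nonneg (by positivity) ha)
      (by rw [norm_smul, norm_inv, norm_norm, inv_mul_cancel₀ hpos'.ne'])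
    rw [← Complex.coe_smul, map_smul, smul_eq_mul, Complex.re_ofReal_mul] at h
    exact nonneg_of_mul_nonneg_right h (by positivity)
  · rintro ⟨η, -, hηE, hη⟩ x hx
    simpa [hηE _ x.2] using hη (x : A) hx
end
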